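/- arXiv:2405.02424 — 2 statements merged into one kernel-verified Lean document; each statement's English description precedes it below -/
import Mathlib

section
/- (Corollary 1) For each k ≥ 1, the map sending an index (i₁,…,i_k) ∈ {1,…,m}^k to the generation-k quantile function x_{i₁…i_k} is injective: distinct indexes yield distinct functions. -/
open MeasureTheory Set

/-- Preference function `ρ_q(x₁,x₂) = ∫₀¹∫₀¹ sign(x₁(u₁) − x₂(u₂)) du₁ du₂`. -/
noncomputable def rhoq (x1 x2 : ℝ → ℝ) : ℝ :=
  ∫ u1 in Ioo (0:ℝ) 1, ∫ u2 in Ioo (0:ℝ) 1, Real.sign (x1 u1 - x2 u2)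

/-- Generation-`k` quantile function `x_{i₁…i_k}(u) = Σ_{l=1}^k ε^l x⁰_{i_l}(u)`. -/
noncomputable def xGen {m k : ℕ} (x0 : Fin m → ℝ → ℝ) (ε : ℝ) (idx : Fin k → Fin m) :
    ℝ → ℝ :=
  fun u => ∑ l : Fin k, ε ^ (l.1 + 1) * x0 (idx l) u

/-- Infinite-generation quantile function `x_{i₁i₂…}(u) = Σ_{l=1}^∞ ε^l x⁰_{i_l}(u)`. -/
noncomputable def xInf {m : ℕ} (x0 : Fin m → ℝ → ℝ) (ε : ℝ) (idx : ℕ → Fin m) : ℝ → ℝ :=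
  fun u => ∑' l : ℕ, ε ^ (l + 1) * x0 (idx l) u

/-- Separation condition: `r ≤ |x⁰_{i₁}(u₁) − x⁰_{i₂}(u₂)| ≤ R` for `i₁ ≠ i₂`, `u₁,u₂ ∈ (0,1)`. -/
def SeparationCond {m : ℕ} (x0 : Fin m → ℝ → ℝ) (r R : ℝ) : Prop :=
  ∀ i₁ i₂ : Fin m, i₁ ≠ i₂ → ∀ u₁ ∈ Ioo (0:ℝ) 1, ∀ u₂ ∈ Ioo (0:ℝ) 1,
    r ≤ |x0 i₁ u₁ - x0 i₂ u₂| ∧ |x0 i₁ u₁ - x0 i₂ u₂| ≤ R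

/-- Intransitive cycle: `ρ_q(y_{j+1}, y_j) > 0` for `1 ≤ j ≤ m−1`, and `ρ_q(y₁, y_m) > 0`. -/
def IntransCycle {m : ℕ} (y : Fin m → ℝ → ℝ) : Prop :=
  (∀ (j : ℕ) (h : j + 1 < m), 0 < rhoq (y ⟨j + 1, h⟩) (y ⟨j, Nat.lt_of_succ_lt h⟩)) ∧
  ∀ (h : 0 < m), 0 < rhoq (y ⟨0, h⟩) (y ⟨m - 1, Nat.sub_lt h Nat.one_pos⟩)

/-- Horner's rule for a sum weighted by powers of `ε` starting at `ε`. -/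
theorem sum_pow_succ_mul_succ {k : ℕ} (ε : ℝ) (d : Fin (k + 1) → ℝ) :
    ∑ l, ε ^ (l.1 + 1) * d l = ε * (d 0 + ∑ l : Fin k, ε ^ (l.1 + 1) * d l.succ) := by
  simp only [Fin.sum_univ_succ, Fin.val_zero, Fin.val_succ, mul_add, Finset.mul_sum]
  congr 1
  · ring
  · exact Finset.sum_congr rfl fun l _ => by ring

theorem abs_sum_pow_succ_mul_lt {ε r R : ℝ} (hε : 0 < ε) (hr : 0 < r) (h : ε * (r + R) ≤ r)
    {k : ℕ} (d : Fin k → ℝ) (hd : ∀ l, |d l| ≤ R) :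
    |∑ l, ε ^ (l.1 + 1) * d l| < r := by
  induction k with
  | zero => simpa using hr
  | succ k ih =>
    rw [sum_pow_succ_mul_succ, abs_mul, abs_of_pos hε]
    refine lt_of_lt_of_le (mul_lt_mul_of_pos_left ?_ hε) h
    linarith [abs_add_le (d 0) (∑ l : Fin k, ε ^ (l.1 + 1) * d l.succ), hd 0,
      ih (fun l => d l.succ) fun l => hd l.succ]

theorem eq_zero_of_sum_pow_succ_mul_eq_zero {ε r R : ℝ} (hε : 0 < ε) (hr : 0 < r)
    (h : ε * (r + R) ≤ r) {k : ℕ} (d : Fin k → ℝ) (hd : ∀ l, |d l| ≤ R)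
    (hd' : ∀ l, d l ≠ 0 → r ≤ |d l|) (hsum : ∑ l, ε ^ (l.1 + 1) * d l = 0) (l : Fin k) :
    d l = 0 := by
  induction k with
  | zero => exact l.elim0
  | succ k ih =>
    rw [sum_pow_succ_mul_succ, mul_eq_zero, or_iff_right hε.ne'] at hsum
    have htail := abs_sum_pow_succ_mul_lt hε hr h (fun l => d l.succ) fun l => hd l.succ
    have h0 : d 0 = 0 := by
      by_contra hne
      rw [← abs_neg, ← eq_neg_of_add_eq_zero_left hsum] at htail
      exact (hd' 0 hne).not_gt htail
    rw [h0, zero_add] at hsum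
    refine Fin.cases h0 (fun j => ?_) l
    exact ih (fun l => d l.succ) (fun l => hd l.succ) (fun l => hd' l.succ) hsum j

theorem generation_index_injective {m : ℕ} (hm : 3 ≤ m) (x0 : Fin m → ℝ → ℝ)
    (hmono : ∀ i, MonotoneOn (x0 i) (Ioo (0:ℝ) 1))
    (r R : ℝ) (hr : 0 < r) (hrR : r ≤ R)
    (hsep : SeparationCond x0 r R)
    (lam ε : ℝ) (hlam : 1 + R / r ≤ lam) (hε : ε = 1 / lam)
    (k : ℕ) (hk : 1 ≤ k) :
    ∀ idx' idx'' : Fin k → Fin m, idx' ≠ idx'' →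
      ∃ u ∈ Ioo (0:ℝ) 1, xGen x0 ε idx' u ≠ xGen x0 ε idx'' u := by
  intro idx' idx'' hne
  have hu : (1 / 2 : ℝ) ∈ Ioo (0 : ℝ) 1 := by norm_num
  refine ⟨1 / 2, hu, fun heq => hne (funext fun l => ?_)⟩
  have hlam0 : 0 < lam := by
    have : 0 < R / r := div_pos (hr.trans_le hrR) hr
    linarith
  have hε0 : 0 < ε := hε ▸ one_div_pos.mpr hlam0
  have hεr : ε * (r + R) ≤ r := by
    have : r + R ≤ r * lam := by
      calc r + R = r * (1 + R / r) := by field_simp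
        _ ≤ r * lam := mul_le_mul_of_nonneg_left hlam hr.le
    rw [hε, one_div_mul_eq_div]
    exact (div_le_iff₀ hlam0).mpr this
  have hzero := eq_zero_of_sum_pow_succ_mul_eq_zero hε0 hr hεr
    (fun l => x0 (idx' l) (1 / 2) - x0 (idx'' l) (1 / 2)) (fun l => ?_) (fun l hl => ?_) ?_ l
  · by_contra hl
    have := (hsep _ _ hl _ hu _ hu).1
    rw [hzero, abs_zero] at this
    exact this.not_gt hr
  · by_cases hl : idx' l = idx'' l
    · simpa [hl] using (hr.trans_le hrR).le
    · exact (hsep _ _ hl _ hu _ hu).2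
  · exact (hsep _ _ (fun h => hl (by simp [h])) _ hu _ hu).1
  · simp only [mul_sub, Finset.sum_sub_distrib]
    exact sub_eq_zero.mpr heq
end

section
/- (Corollary 4) Let λ > 1 + R/r. The map sending an infinite index (i₁, i₂, …) ∈ {1,…,m}^ℕ to the infinite-generation quantile function x_{i₁i₂…} is injective: distinct infinite indexes yield distinct functions. -/
open MeasureTheory Set

/-- A power series `∑ ε^(l+1) d_l` whose first nonzero coefficient dominates the geometric bound
on the remaining terms does not vanish. -/
theorem tsum_pow_succ_mul_ne_zero {d : ℕ → ℝ} {ε r R : ℝ} {n : ℕ} (hε0 : 0 < ε) (hε1 : ε < 1)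
    (hεR : R * ε < r * (1 - ε)) (hR : ∀ l, |d l| ≤ R) (hzero : ∀ l < n, d l = 0)
    (hn : r ≤ |d n|) : ∑' l : ℕ, ε ^ (l + 1) * d l ≠ 0 := by
  have hbound (k l : ℕ) : ‖ε ^ (l + k + 1) * d (l + k)‖ ≤ ε ^ (k + 1) * R * ε ^ l := by
    rw [norm_mul, norm_pow, Real.norm_of_nonneg hε0.le, Real.norm_eq_abs]
    calc ε ^ (l + k + 1) * |d (l + k)| ≤ ε ^ (l + k + 1) * R := by gcongr; exact hR _
      _ = ε ^ (k + 1) * R * ε ^ l := by ring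
  have hgeom (k : ℕ) : HasSum (fun l => ε ^ (k + 1) * R * ε ^ l) (ε ^ (k + 1) * R * (1 - ε)⁻¹) :=
    (hasSum_geometric_of_lt_one hε0.le hε1).mul_left _
  have hsum : Summable fun l => ε ^ (l + 1) * d l :=
    Summable.of_norm_bounded (hgeom 0).summable (hbound 0)
  have htail := tsum_of_norm_bounded (hgeom (n + 1)) (hbound (n + 1))
  have hhead : ∑ l ∈ Finset.range n, ε ^ (l + 1) * d l = 0 :=
    Finset.sum_eq_zero fun l hl => by rw [hzero l (Finset.mem_range.mp hl), mul_zero]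
  intro h
  rw [← hsum.sum_add_tsum_nat_add (n + 1), Finset.sum_range_succ, hhead, zero_add] at h
  rw [eq_neg_of_add_eq_zero_right h, norm_neg, norm_mul, norm_pow, Real.norm_of_nonneg hε0.le,
    Real.norm_eq_abs, ← div_eq_mul_inv, le_div_iff₀ (sub_pos.mpr hε1)] at htail
  have hlead : ε ^ (n + 1) * (r * (1 - ε)) ≤ ε ^ (n + 1) * |d n| * (1 - ε) := by
    rw [mul_assoc]
    have := sub_pos.mpr hε1
    gcongr
  have hlt : ε ^ (n + 1) * (R * ε) < ε ^ (n + 1) * (r * (1 - ε)) := by gcongr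
  have : ε ^ (n + 1 + 1) * R = ε ^ (n + 1) * (R * ε) := by ring
  linarith

theorem summable_pow_succ_mul_of_finite {ι : Type*} [Finite ι] {ε : ℝ} (hε0 : 0 ≤ ε)
    (hε1 : ε < 1) (a : ι → ℝ) (idx : ℕ → ι) : Summable fun l : ℕ => ε ^ (l + 1) * a (idx l) := by
  obtain ⟨C, hC⟩ := (Set.finite_range fun i => |a i|).bddAbove
  refine Summable.of_norm_bounded
    (((summable_nat_add_iff 1).mpr (summable_geometric_of_lt_one hε0 hε1)).mul_right C) fun l => ?_
  rw [norm_mul, norm_pow, Real.norm_of_nonneg hε0, Real.norm_eq_abs]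
  gcongr
  exact hC ⟨idx l, rfl⟩

theorem infinite_generation_index_injective {m : ℕ} (hm : 3 ≤ m) (x0 : Fin m → ℝ → ℝ)
    (hmono : ∀ i, MonotoneOn (x0 i) (Ioo (0:ℝ) 1))
    (r R : ℝ) (hr : 0 < r) (hrR : r ≤ R)
    (hsep : SeparationCond x0 r R)
    (lam ε : ℝ) (hlam : 1 + R / r < lam) (hε : ε = 1 / lam) :
    ∀ idx' idx'' : ℕ → Fin m, idx' ≠ idx'' →
      ∃ u ∈ Ioo (0:ℝ) 1, xInf x0 ε idx' u ≠ xInf x0 ε idx'' u := by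
  intro idx' idx'' hne
  have hu : (1 / 2 : ℝ) ∈ Ioo (0 : ℝ) 1 := by norm_num
  have hRr : 0 < R / r := div_pos (hr.trans_le hrR) hr
  have hlam1 : 1 < lam := by linarith
  have hlam0 : 0 < lam := by linarith
  have hε0 : 0 < ε := by rw [hε]; positivity
  have hε1 : ε < 1 := by rw [hε, div_lt_one hlam0]; exact hlam1
  have hlamε : lam * ε = 1 := by rw [hε]; field_simp
  have hεR : R * ε < r * (1 - ε) := by
    have hR : R < (lam - 1) * r := (div_lt_iff₀ hr).mp (by linarith)
    calc R * ε < (lam - 1) * r * ε := by gcongr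
      _ = r * (1 - ε) := by linear_combination r * hlamε
  refine ⟨1 / 2, hu, fun heq => ?_⟩
  have hex : ∃ n, idx' n ≠ idx'' n := Function.ne_iff.mp hne
  classical
  refine tsum_pow_succ_mul_ne_zero (d := fun l => x0 (idx' l) (1 / 2) - x0 (idx'' l) (1 / 2))
    (n := Nat.find hex) hε0 hε1 hεR (fun l => ?_) (fun l hl => ?_)
    (hsep _ _ (Nat.find_spec hex) _ hu _ hu).1 ?_
  · by_cases h : idx' l = idx'' l
    · simpa [h] using hr.le.trans hrR
    · exact (hsep _ _ h _ hu _ hu).2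
  · rw [not_not.mp (Nat.find_min hex hl), sub_self]
  · simp only [mul_sub]
    rw [(summable_pow_succ_mul_of_finite hε0.le hε1 (fun i => x0 i (1 / 2)) idx').tsum_sub
      (summable_pow_succ_mul_of_finite hε0.le hε1 (fun i => x0 i (1 / 2)) idx'')]
    exact sub_eq_zero.mpr heq
end
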